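/- Let a ≥ 0, b ∈ ℝ, T > 0, k > 0, G ∈ L¹(ℝ), h ∈ L²(ℝ) with h ≥ 0. Let v : ℝ × [0,T] → ℝ be measurable with v(·,t) ∈ L²(ℝ) for a.e. t and ∫₀ᵀ ‖v(·,t)‖²_{L²(ℝ)} dt < ∞, and let w : ℝ × [0,T] → ℝ be measurable with w(·,s) ∈ L¹(ℝ) ∩ L²(ℝ) and ‖w(·,s)‖_{L²(ℝ)} ≤ k‖v(·,s)‖_{L²(ℝ)} + ‖h‖_{L²(ℝ)} for a.e. s ∈ [0,T]. Then ∫₀ᵀ ∫_ℝ | ∫₀ᵗ e^{(t−s)(−p⁴+ibp+a)} √(2π) Ĝ(p) ŵ(p,s) ds |² dp dt ≤ e^{2aT} ‖G‖²_{L¹(ℝ)} T² ( k‖v‖_{L²(ℝ×[0,T])} + √T ‖h‖_{L²(ℝ)} )². -/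

import Mathlib

open MeasureTheory

/-- The Fourier transform `φ̂(p) = (2π)^{-1/2} ∫ φ(x) e^{-ipx} dx`. -/
noncomputable def FT (φ : ℝ → ℝ) (p : ℝ) : ℂ :=
  (Real.sqrt (2 * Real.pi))⁻¹ *
    ∫ x : ℝ, (φ x : ℂ) * Complex.exp (-(Complex.I * p * x))

open FourierTransform in
lemma aux_planch (f : ℝ → ℂ) (h1 : Integrable f) (h2 : MemLp f 2) :
    ∫⁻ x, ‖𝓕 f x‖ₑ ^ 2 = ∫⁻ x, ‖f x‖ₑ ^ 2 := by
  have hae : ∀ᵐ x, (𝓕 (h2.toLp f) : Lp ℂ 2 (volume : Measure ℝ)) x = 𝓕 f x := by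
    have hcont : Continuous (𝓕 f) :=
      VectorFourier.fourierIntegral_continuous Real.continuous_fourierChar
        (by exact continuous_inner) h1
    apply ae_eq_of_integral_contDiff_smul_eq
    · exact (Lp.memLp _).locallyIntegrable (by norm_num)
    · exact hcont.locallyIntegrable
    · intro g g_smooth g_cpt
      have hg₁ : HasCompactSupport (Complex.ofRealCLM ∘ g) := g_cpt.comp_left rfl
      have hg₂ : ContDiff ℝ (↑(⊤ : ℕ∞)) (Complex.ofRealCLM ∘ g) :=
        Complex.ofRealCLM.contDiff.comp g_smooth
      set gs := hg₁.toSchwartzMap hg₂ with hgs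
      have e1 := congrArg (fun u => u gs) (Lp.fourier_toTemperedDistribution_eq (h2.toLp f))
      simp only [TemperedDistribution.fourier_apply, Lp.toTemperedDistribution_apply] at e1
      have e2 : ∫ x, gs x • 𝓕 f x = ∫ x, (𝓕 gs) x • f x := by
        have := VectorFourier.integral_fourierIntegral_smul_eq_flip (μ := volume) (ν := volume)
          (L := innerₗ ℝ) (f := gs) (g := f) Real.continuous_fourierChar
          (by exact continuous_inner) gs.integrable h1
        rw [flip_innerₗ] at this
        exact this.symm
      have e3 : ∫ x, (𝓕 gs) x • f x = ∫ x, (𝓕 gs) x • (h2.toLp f) x := by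
        apply integral_congr_ae
        filter_upwards [h2.coeFn_toLp] with x hx
        rw [hx]
      have e4 : ∀ u : ℝ → ℂ, ∫ x, g x • u x = ∫ x, gs x • u x := by
        intro u
        congr 1
      rw [e4, e4, e2, e3, e1]
  have hn := Lp.norm_fourier_eq (h2.toLp f)
  have hn2 : ‖(𝓕 (h2.toLp f) : Lp ℂ 2 (volume : Measure ℝ))‖ₑ = ‖h2.toLp f‖ₑ := by
    rw [← ofReal_norm, hn, ofReal_norm]
  rw [Lp.enorm_def, Lp.enorm_def, eLpNorm_congr_ae hae, eLpNorm_congr_ae h2.coeFn_toLp] at hn2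
  have key : ∀ u : ℝ → ℂ, ∫⁻ x, ‖u x‖ₑ ^ 2 = eLpNorm u 2 volume ^ 2 := by
    intro u
    have := eLpNorm_nnreal_pow_eq_lintegral (f := u) (μ := volume) (p := 2) (by norm_num)
    simpa using this.symm
  rw [key, key]
  exact congrArg (· ^ 2) hn2

open FourierTransform in
lemma aux_FT_eq (φ : ℝ → ℝ) (p : ℝ) :
    FT φ p = ((Real.sqrt (2 * Real.pi))⁻¹ : ℝ) * 𝓕 (fun x => (φ x : ℂ)) ((2 * Real.pi)⁻¹ * p) := by
  rw [FT, Real.fourier_real_eq_integral_exp_smul]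
  push_cast
  congr 2
  ext x
  rw [smul_eq_mul, mul_comm]
  congr 2
  push_cast
  field_simp [Real.pi_ne_zero]

lemma aux_scale (u : ℝ → ENNReal) (hu : Measurable u) (c : ℝ) (hc : 0 < c) :
    ∫⁻ p, u (c * p) = ENNReal.ofReal c⁻¹ * ∫⁻ p, u p := by
  have h := Real.map_volume_mul_left hc.ne'
  rw [← lintegral_map hu (measurable_const_mul c), h, lintegral_smul_measure,
    abs_of_pos (inv_pos.2 hc)]
  rfl

lemma aux_FT_planch (φ : ℝ → ℝ) (h1 : Integrable φ) (h2 : Integrable (fun x => φ x ^ 2)) :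
    ∫⁻ p, ‖FT φ p‖ₑ ^ 2 = ENNReal.ofReal (∫ x, φ x ^ 2) := by
  have hm : MemLp φ 2 := (memLp_two_iff_integrable_sq h1.1).2 h2
  have hc : Continuous (FourierTransform.fourier (fun x => (φ x : ℂ))) :=
      VectorFourier.fourierIntegral_continuous Real.continuous_fourierChar
        (by exact continuous_inner) h1.ofReal
  have hpl := aux_planch (fun x => (φ x : ℂ)) h1.ofReal hm.ofReal
  have hpi : 0 < 2 * Real.pi := by positivity
  simp_rw [aux_FT_eq, enorm_mul, mul_pow]
  rw [lintegral_const_mul' _ _ (ENNReal.pow_ne_top enorm_ne_top),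
    aux_scale (fun q => ‖FourierTransform.fourier (fun x => (φ x : ℂ)) q‖ₑ ^ 2)
      (by fun_prop) _ (inv_pos.2 hpi), hpl, ← mul_assoc, inv_inv]
  have hone : ‖(((Real.sqrt (2 * Real.pi))⁻¹ : ℝ) : ℂ)‖ₑ ^ 2 * ENNReal.ofReal (2 * Real.pi) = 1 := by
    rw [← ofReal_norm, ← ENNReal.ofReal_pow (norm_nonneg _),
      ← ENNReal.ofReal_mul (by positivity), Complex.norm_real, Real.norm_eq_abs, sq_abs, inv_pow,
      Real.sq_sqrt hpi.le, inv_mul_cancel₀ hpi.ne', ENNReal.ofReal_one]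
  rw [hone, one_mul, ofReal_integral_eq_lintegral_ofReal h2 (Filter.Eventually.of_forall fun x => sq_nonneg _)]
  congr 1
  ext x
  rw [← ofReal_norm, ← ENNReal.ofReal_pow (norm_nonneg _), Complex.norm_real,
    Real.norm_eq_abs, sq_abs]

lemma aux_FT_bound (G : ℝ → ℝ) (p : ℝ) :
    ‖(Real.sqrt (2 * Real.pi) : ℂ) * FT G p‖ ≤ ∫ x, |G x| := by
  have hpi : 0 < Real.sqrt (2 * Real.pi) := by positivity
  have : (Real.sqrt (2 * Real.pi) : ℂ) ≠ 0 := by exact_mod_cast hpi.ne'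
  rw [FT, Complex.ofReal_inv, mul_inv_cancel_left₀ this]
  refine (norm_integral_le_integral_norm _).trans (le_of_eq ?_)
  congr 1
  ext x
  rw [norm_mul, Complex.norm_real, Real.norm_eq_abs, Complex.norm_exp]
  simp

lemma aux_meas (w : ℝ → ℝ → ℝ) (hw : Measurable (Function.uncurry w)) :
    Measurable (fun z : ℝ × ℝ => ‖FT (fun x => w x z.2) z.1‖ₑ ^ 2) := by
  have h1 : StronglyMeasurable (fun z : ℝ × ℝ => ∫ x : ℝ, ((w x z.2 : ℝ) : ℂ) *
      Complex.exp (-(Complex.I * z.1 * x))) := by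
    apply StronglyMeasurable.integral_prod_right' (ν := (volume : Measure ℝ))
      (f := fun q : (ℝ × ℝ) × ℝ => ((w q.2 q.1.2 : ℝ) : ℂ) * Complex.exp (-(Complex.I * q.1.1 * q.2)))
    apply Measurable.stronglyMeasurable
    have : Measurable (fun q : (ℝ × ℝ) × ℝ => w q.2 q.1.2) :=
      hw.comp (measurable_snd.prodMk (measurable_snd.comp measurable_fst))
    fun_prop
  have h2 := h1.measurable
  unfold FT
  fun_prop

lemma aux_meas_slice (w : ℝ → ℝ → ℝ) (hw : Measurable (Function.uncurry w)) (p : ℝ) :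
    Measurable (fun s => ‖FT (fun x => w x s) p‖ₑ) := by
  have h1 : StronglyMeasurable (fun s : ℝ => ∫ x : ℝ, ((w x s : ℝ) : ℂ) *
      Complex.exp (-(Complex.I * p * x))) := by
    apply StronglyMeasurable.integral_prod_right' (ν := (volume : Measure ℝ))
      (f := fun q : ℝ × ℝ => ((w q.2 q.1 : ℝ) : ℂ) * Complex.exp (-(Complex.I * p * q.2)))
    apply Measurable.stronglyMeasurable
    have : Measurable (fun q : ℝ × ℝ => w q.2 q.1) := hw.comp measurable_swap
    fun_prop
  have h2 := h1.measurable
  unfold FT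
  fun_prop

lemma aux_swap (w : ℝ → ℝ → ℝ) (hw : Measurable (Function.uncurry w)) (μ : Measure ℝ) [SFinite μ] :
    ∫⁻ p, ∫⁻ s, ‖FT (fun x => w x s) p‖ₑ ^ 2 ∂μ =
      ∫⁻ s, (∫⁻ p, ‖FT (fun x => w x s) p‖ₑ ^ 2) ∂μ :=
  lintegral_lintegral_swap (f := fun p s => ‖FT (fun x => w x s) p‖ₑ ^ 2)
    (aux_meas w hw).aemeasurable

lemma aux_cs (μ : Measure ℝ) (f : ℝ → ENNReal) (hf : AEMeasurable f μ) :
    (∫⁻ s, f s ∂μ) ^ 2 ≤ μ Set.univ * ∫⁻ s, f s ^ 2 ∂μ := by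
  have := ENNReal.lintegral_mul_le_Lp_mul_Lq μ (Real.HolderConjugate.two_two) hf
    (aemeasurable_const (b := (1 : ENNReal)))
  simp only [Pi.mul_apply, mul_one, ENNReal.one_rpow, lintegral_const, one_mul] at this
  calc _ ≤ ((∫⁻ s, f s ^ (2:ℝ) ∂μ) ^ (1 / (2:ℝ)) * μ Set.univ ^ (1 / (2:ℝ))) ^ 2 := by gcongr
    _ = _ := by
      rw [mul_pow, ← ENNReal.rpow_natCast, ← ENNReal.rpow_natCast, ← ENNReal.rpow_mul, ← ENNReal.rpow_mul]
      norm_num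
      rw [mul_comm]

lemma aux_mink (μ : Measure ℝ) (f g : ℝ → ENNReal) (hf : AEMeasurable f μ) (hg : AEMeasurable g μ)
    (A B : ENNReal) (hA : ∫⁻ s, f s ^ 2 ∂μ = A ^ 2) (hB : ∫⁻ s, g s ^ 2 ∂μ = B ^ 2) :
    ∫⁻ s, (f s + g s) ^ 2 ∂μ ≤ (A + B) ^ 2 := by
  have := ENNReal.lintegral_Lp_add_le hf hg (p := 2) (by norm_num)
  simp only [Pi.add_apply, ENNReal.rpow_two, hA, hB] at this
  have e : ∀ X : ENNReal, (X ^ 2) ^ (1 / (2:ℝ)) = X := fun X => by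
    rw [← ENNReal.rpow_two, ← ENNReal.rpow_mul]; norm_num
  rw [e, e] at this
  calc _ = ((∫⁻ s, (f s + g s) ^ 2 ∂μ) ^ (1 / (2:ℝ))) ^ 2 := by
        rw [← ENNReal.rpow_natCast (_ ^ (1 / (2:ℝ))), ← ENNReal.rpow_mul]; norm_num
    _ ≤ _ := by gcongr

lemma aux_kernel (a b T : ℝ) (ha : 0 ≤ a) (G : ℝ → ℝ) (w : ℝ → ℝ → ℝ) (t p : ℝ)
    (ht : t ∈ Set.Ioc 0 T) :
    ‖∫ s in (0:ℝ)..t,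
            Complex.exp (((t - s : ℝ) : ℂ) * (-(p : ℂ) ^ 4 + Complex.I * b * p + a)) *
              (Real.sqrt (2 * Real.pi) : ℂ) * FT G p * FT (fun x => w x s) p‖ₑ ≤
      ENNReal.ofReal (Real.exp (a * T) * ∫ x, |G x|) *
        ∫⁻ s in Set.Ioc 0 T, ‖FT (fun x => w x s) p‖ₑ := by
  rw [intervalIntegral.integral_of_le ht.1.le]
  refine (enorm_integral_le_lintegral_enorm _).trans ?_
  rw [← lintegral_const_mul' _ _ ENNReal.ofReal_ne_top]
  refine le_trans ?_ (lintegral_mono_set (Set.Ioc_subset_Ioc_right ht.2))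
  refine setLIntegral_mono' measurableSet_Ioc ?_
  intro s hs
  rw [enorm_mul]
  gcongr
  rw [mul_assoc, ← ofReal_norm]
  apply ENNReal.ofReal_le_ofReal
  rw [norm_mul]
  refine mul_le_mul ?_ (aux_FT_bound G p) (norm_nonneg _) (Real.exp_pos _).le
  rw [Complex.norm_exp]
  apply Real.exp_le_exp.2
  have e : (((t - s : ℝ) : ℂ) * (-(p : ℂ) ^ 4 + Complex.I * b * p + a)).re
      = (t - s) * (-p ^ 4 + a) := by
    rw [Complex.re_ofReal_mul]
    have : (-(p : ℂ) ^ 4 + Complex.I * b * p + a)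
      = ((-p ^ 4 + a : ℝ) : ℂ) + ((b * p : ℝ) : ℂ) * Complex.I := by push_cast; ring
    rw [this]
    simp only [Complex.add_re, Complex.ofReal_re, Complex.re_ofReal_mul, Complex.I_re, mul_zero,
      add_zero]
  rw [e]
  have h1 : 0 ≤ t - s := by linarith [hs.2]
  have h2 : 0 ≤ (t - s) * p ^ 4 := by positivity
  have h3 : 0 ≤ (T - t + s) * a := mul_nonneg (by linarith [hs.1, ht.2]) ha
  nlinarith

theorem stmt7 (a b T k : ℝ) (ha : 0 ≤ a) (hT : 0 < T) (hk : 0 < k)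
    (G : ℝ → ℝ) (hG : Integrable G)
    (h : ℝ → ℝ) (hh2 : Integrable (fun x => (h x) ^ 2)) (hhpos : ∀ x, 0 ≤ h x)
    (v : ℝ → ℝ → ℝ) (hvmeas : Measurable (Function.uncurry v))
    (hv2 : ∀ᵐ t ∂(volume.restrict (Set.Icc (0:ℝ) T)),
      Integrable (fun x => (v x t) ^ 2))
    (hvL2 : (∫⁻ t in Set.Icc (0:ℝ) T,
      ENNReal.ofReal (∫ x : ℝ, (v x t) ^ 2)) < ⊤)
    (w : ℝ → ℝ → ℝ) (hwmeas : Measurable (Function.uncurry w))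
    (hw : ∀ᵐ s ∂(volume.restrict (Set.Icc (0:ℝ) T)),
      Integrable (fun x => w x s) ∧ Integrable (fun x => (w x s) ^ 2) ∧
        Real.sqrt (∫ x : ℝ, (w x s) ^ 2) ≤
          k * Real.sqrt (∫ x : ℝ, (v x s) ^ 2) + Real.sqrt (∫ x : ℝ, (h x) ^ 2)) :
    ∫ t in (0:ℝ)..T, ∫ p : ℝ,
        ‖∫ s in (0:ℝ)..t,
            Complex.exp (((t - s : ℝ) : ℂ) * (-(p : ℂ) ^ 4 + Complex.I * b * p + a)) *
              (Real.sqrt (2 * Real.pi) : ℂ) * FT G p * FT (fun x => w x s) p‖ ^ 2 ≤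
      Real.exp (2 * a * T) * (∫ x : ℝ, |G x|) ^ 2 * T ^ 2 *
        (k * Real.sqrt (∫ t in (0:ℝ)..T, ∫ x : ℝ, (v x t) ^ 2) +
          Real.sqrt T * Real.sqrt (∫ x : ℝ, (h x) ^ 2)) ^ 2 := by
  have hμ : (volume.restrict (Set.Icc (0:ℝ) T)) = volume.restrict (Set.Ioc (0:ℝ) T) :=
    Measure.restrict_congr_set Ioc_ae_eq_Icc.symm
  rw [hμ] at hv2 hvL2 hw
  set μ := volume.restrict (Set.Ioc (0:ℝ) T) with hμdef
  have hμu : μ Set.univ = ENNReal.ofReal T := by simp [hμdef]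
  set A := Real.exp (a * T) * ∫ x, |G x| with hAdef
  have hA0 : 0 ≤ A := mul_nonneg (Real.exp_pos _).le (integral_nonneg fun x => abs_nonneg _)
  set H := Real.sqrt (∫ x : ℝ, (h x) ^ 2) with hHdef
  have hH0 : 0 ≤ H := Real.sqrt_nonneg _
  have hVm : StronglyMeasurable (fun t => ∫ x, (v x t) ^ 2) := by
    apply StronglyMeasurable.integral_prod_right' (ν := (volume : Measure ℝ))
      (f := fun q : ℝ × ℝ => (v q.2 q.1) ^ 2)
    exact ((hvmeas.comp measurable_swap).pow_const 2).stronglyMeasurable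
  have hVm' := hVm.measurable
  have hV0 : ∀ t, 0 ≤ ∫ x, (v x t) ^ 2 := fun t => integral_nonneg fun x => sq_nonneg _
  have hVi : Integrable (fun t => ∫ x, (v x t) ^ 2) μ := by
    refine ⟨hVm.aestronglyMeasurable, ?_⟩
    rw [hasFiniteIntegral_iff_ofReal (Filter.Eventually.of_forall hV0)]
    exact hvL2
  set VV := ∫ t in (0:ℝ)..T, ∫ x : ℝ, (v x t) ^ 2 with hVV
  have hVV' : VV = ∫ t, (∫ x : ℝ, (v x t) ^ 2) ∂μ := by
    rw [hVV, intervalIntegral.integral_of_le hT.le]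
  have hVV0 : 0 ≤ VV := by rw [hVV']; exact integral_nonneg hV0
  -- Minkowski
  have hW : ∫⁻ s, (∫⁻ p, ‖FT (fun x => w x s) p‖ₑ ^ 2) ∂μ ≤
      ENNReal.ofReal ((k * Real.sqrt VV + Real.sqrt T * H) ^ 2) := by
    have hm := aux_mink μ (fun s => ENNReal.ofReal (k * Real.sqrt (∫ x, (v x s) ^ 2)))
      (fun _ => ENNReal.ofReal H) ((hVm'.sqrt.const_mul k).ennreal_ofReal.aemeasurable)
      aemeasurable_const
      (ENNReal.ofReal (k * Real.sqrt VV)) (ENNReal.ofReal (Real.sqrt T * H))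
      (by
        rw [← ENNReal.ofReal_pow (by positivity), mul_pow, Real.sq_sqrt hVV0,
          ENNReal.ofReal_mul (by positivity), hVV',
          ofReal_integral_eq_lintegral_ofReal hVi (Filter.Eventually.of_forall hV0),
          ← lintegral_const_mul' _ _ ENNReal.ofReal_ne_top]
        congr 1
        ext s
        rw [← ENNReal.ofReal_pow (by positivity), mul_pow, Real.sq_sqrt (hV0 s),
          ENNReal.ofReal_mul (by positivity)])
      (by
        rw [lintegral_const, hμu, ← ENNReal.ofReal_pow hH0, ← ENNReal.ofReal_mul (by positivity),
          ← ENNReal.ofReal_pow (by positivity), mul_pow, Real.sq_sqrt hT.le, mul_comm])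
    rw [← ENNReal.ofReal_add (by positivity) (by positivity),
      ← ENNReal.ofReal_pow (by positivity)] at hm
    refine le_trans (lintegral_mono_ae ?_) hm
    filter_upwards [hw] with s hs
    rw [aux_FT_planch _ hs.1 hs.2.1, ← ENNReal.ofReal_add (by positivity) (by positivity),
      ← ENNReal.ofReal_pow (by positivity)]
    apply ENNReal.ofReal_le_ofReal
    rw [← Real.sq_sqrt (integral_nonneg fun x => sq_nonneg (w x s))]
    exact pow_le_pow_left₀ (Real.sqrt_nonneg _) hs.2.2 2
  -- bound for fixed time
  have hkey : ∀ t ∈ Set.Ioc 0 T, ‖∫ p : ℝ,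
        ‖∫ s in (0:ℝ)..t,
            Complex.exp (((t - s : ℝ) : ℂ) * (-(p : ℂ) ^ 4 + Complex.I * b * p + a)) *
              (Real.sqrt (2 * Real.pi) : ℂ) * FT G p * FT (fun x => w x s) p‖ ^ 2‖ₑ ≤
      ENNReal.ofReal A ^ 2 * (ENNReal.ofReal T *
        ENNReal.ofReal ((k * Real.sqrt VV + Real.sqrt T * H) ^ 2)) := by
    intro t ht
    refine (enorm_integral_le_lintegral_enorm _).trans ?_
    calc _ ≤ ∫⁻ p, ENNReal.ofReal A ^ 2 *
          (ENNReal.ofReal T * ∫⁻ s, ‖FT (fun x => w x s) p‖ₑ ^ 2 ∂μ) := by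
          apply lintegral_mono
          intro p
          dsimp only
          rw [enorm_pow, enorm_norm]
          calc _ ≤ (ENNReal.ofReal A * ∫⁻ s, ‖FT (fun x => w x s) p‖ₑ ∂μ) ^ 2 := by
                exact pow_le_pow_left' (aux_kernel a b T ha G w t p ht) 2
            _ ≤ _ := by
                rw [mul_pow]
                refine mul_le_mul' le_rfl ?_
                rw [← hμu]
                apply aux_cs
                exact (aux_meas_slice w hwmeas p).aemeasurable
      _ = ENNReal.ofReal A ^ 2 * (ENNReal.ofReal T *
          ∫⁻ s, (∫⁻ p, ‖FT (fun x => w x s) p‖ₑ ^ 2) ∂μ) := by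
          rw [lintegral_const_mul' _ _ (ENNReal.pow_ne_top ENNReal.ofReal_ne_top),
            lintegral_const_mul' _ _ ENNReal.ofReal_ne_top]
          rw [aux_swap w hwmeas μ]
      _ ≤ _ := mul_le_mul' le_rfl (mul_le_mul' le_rfl hW)
  rw [← ENNReal.ofReal_le_ofReal_iff (by positivity)]
  rw [intervalIntegral.integral_of_le hT.le]
  refine (Real.ofReal_le_enorm _).trans ?_
  refine (enorm_integral_le_lintegral_enorm _).trans ?_
  refine (setLIntegral_mono' measurableSet_Ioc hkey).trans ?_
  rw [setLIntegral_const, Real.volume_Ioc, sub_zero, ← ENNReal.ofReal_pow hA0,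
    ← ENNReal.ofReal_mul hT.le, ← ENNReal.ofReal_mul (by positivity),
    ← ENNReal.ofReal_mul (by positivity)]
  apply ENNReal.ofReal_le_ofReal
  apply le_of_eq
  have : Real.exp (2 * a * T) = Real.exp (a * T) ^ 2 := by
    rw [← Real.exp_nat_mul]; congr 1; push_cast; ring
  rw [this, hAdef]
  ring
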